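/- arXiv:1411.5407 — 5 statements merged into one kernel-verified Lean document; each statement's English description precedes it below -/
import Mathlib

section
/- Let ℒ be a lattice on ℝ, let f be 𝔄_∞-measurable with Mf ∈ L¹(ℝ), and let (|a_I|)_{I∈ℒ} be a Carleson sequence, where (a_I)_{I∈ℒ} are real numbers. Then Σ_{I∈ℒ} |⟨f⟩_I| |a_I| ≤ ‖Mf‖_{L¹} · Carl(|a_I|); in particular the sum Σ_{I∈ℒ} ⟨f⟩_I a_I converges absolutely and |Σ_{I∈ℒ} ⟨f⟩_I a_I| ≤ ‖f‖_{H¹_*} · Carl(|a_I|). -/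
open MeasureTheory Set Filter
open scoped ENNReal Topology Classical

noncomputable section

/-- The average `⟨f⟩_I = (1/|I|) ∫_I f` of `f` over a set `I`. -/
def avgOn (f : ℝ → ℝ) (I : Set ℝ) : ℝ := (MeasureTheory.volume I).toReal⁻¹ * ∫ x in I, f x

/-- The averaging operator `E_I f = ⟨f⟩_I · 1_I`. -/
def avgInd (f : ℝ → ℝ) (I : Set ℝ) : ℝ → ℝ := I.indicator fun _ => avgOn f I

/-- A lattice `ℒ` on `ℝ`: a family of generations `ℒ_k`, `k ∈ ℤ`, each a collection of
pairwise disjoint nontrivial finite intervals covering `ℝ`, each interval of generation `k`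
being a finite (disjoint) union of intervals of generation `k+1`. -/
structure RLattice where
  gen : ℤ → Set (Set ℝ)
  isInterval : ∀ k : ℤ, ∀ I ∈ gen k, ∃ a b : ℝ, a < b ∧ I = Set.Ico a b
  pairwise_disjoint : ∀ k : ℤ, (gen k).PairwiseDisjoint id
  covers : ∀ k : ℤ, ⋃₀ gen k = Set.univ
  subdiv : ∀ k : ℤ, ∀ J ∈ gen (k + 1), ∀ I ∈ gen k, J ⊆ I ∨ Disjoint J I
  finite_children : ∀ k : ℤ, ∀ I ∈ gen k, {J | J ∈ gen (k + 1) ∧ J ⊆ I}.Finite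

namespace RLattice

variable (L : RLattice)

/-- The collection of all intervals of the lattice. -/
def lat : Set (Set ℝ) := {I | ∃ k, I ∈ L.gen k}

/-- The conditional expectation `E_k f = Σ_{I ∈ ℒ_k} E_I f`. -/
def Ek (f : ℝ → ℝ) (k : ℤ) (x : ℝ) : ℝ := ∑' I : L.gen k, avgInd f I.1 x

/-- The children of `I`: the intervals `J ∈ ℒ_{rk(I)+1}`, `J ⊆ I`, where `rk(I)` is the
largest `k` with `I ∈ ℒ_k`. -/
def children (I : Set ℝ) : Set (Set ℝ) :=
  {J | ∃ k : ℤ, I ∈ L.gen k ∧ I ∉ L.gen (k + 1) ∧ J ∈ L.gen (k + 1) ∧ J ⊆ I}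

/-- The difference operator `Δ_I f = -E_I f + Σ_{J ∈ child(I)} E_J f` (interpreted as `0`
when `I` has no finite rank, i.e. no children). -/
def deltaI (f : ℝ → ℝ) (I : Set ℝ) (x : ℝ) : ℝ :=
  if (L.children I).Nonempty then (∑' J : L.children I, avgInd f J.1 x) - avgInd f I x else 0

/-- The martingale difference `Δ_k f = E_k f - E_{k-1} f`. -/
def deltaK (f : ℝ → ℝ) (k : ℤ) (x : ℝ) : ℝ := L.Ek f k x - L.Ek f (k - 1) x

/-- The collection `𝔄⁰_{-∞,fin}` of finite-measure intervals of the form `⋃_k I_k`,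
`I_k ∈ ℒ_k`, `I_k ⊆ I_{k-1}`. -/
def AFin : Set (Set ℝ) :=
  {I | MeasureTheory.volume I < ⊤ ∧ ∃ c : ℤ → Set ℝ,
    (∀ k, c k ∈ L.gen k) ∧ (∀ k, c k ⊆ c (k - 1)) ∧ I = ⋃ k, c k}

/-- `f` is `𝔄_∞`-measurable: Borel measurable and constant on every interval of the form
`⋂_k I_k`, `I_k ∈ ℒ_k`, `I_k ⊆ I_{k-1}`. -/
def AInfMeasurable (f : ℝ → ℝ) : Prop :=
  Measurable f ∧ ∀ c : ℤ → Set ℝ, (∀ k, c k ∈ L.gen k) → (∀ k, c k ⊆ c (k - 1)) →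
    ∀ x ∈ ⋂ k, c k, ∀ y ∈ ⋂ k, c k, f x = f y

/-- The maximal function `Mf(x) = sup {|⟨f⟩_I| : I ∈ ℒ, x ∈ I}`, valued in `[0,∞]`. -/
def maxFn (f : ℝ → ℝ) (x : ℝ) : ℝ≥0∞ :=
  ⨆ (I : Set ℝ) (_ : I ∈ L.lat ∧ x ∈ I), ENNReal.ofReal |avgOn f I|

/-- The square function
`Sf = (Σ_{I ∈ ℒ} |Δ_I f|² + Σ_{I ∈ 𝔄⁰_{-∞,fin}} |E_I f|²)^{1/2}`, valued in `[0,∞]`. -/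
def sqFn (f : ℝ → ℝ) (x : ℝ) : ℝ≥0∞ :=
  ((∑' I : L.lat, ENNReal.ofReal ((L.deltaI f I.1 x) ^ 2)) +
    ∑' I : L.AFin, ENNReal.ofReal ((avgInd f I.1 x) ^ 2)) ^ (1 / 2 : ℝ)

/-- `a` (nonnegative) is a Carleson sequence with constant `C`:
`Σ_{J ∈ ℒ, J ⊆ I} a_J ≤ C|I|` for every `I ∈ ℒ ∪ 𝔄⁰_{-∞,fin}`. -/
def IsCarleson (a : Set ℝ → ℝ) (C : ℝ) : Prop :=
  ∀ I ∈ L.lat ∪ L.AFin,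
    ∑' J : {J : Set ℝ // J ∈ L.lat ∧ J ⊆ I}, ENNReal.ofReal (a J.1)
      ≤ ENNReal.ofReal C * MeasureTheory.volume I

/-- The balayage `g = Σ_{I ∈ ℒ} (1/|I|) a_I 1_I` of a sequence `(a_I)_{I ∈ ℒ}`. -/
def balayage (a : Set ℝ → ℝ) (x : ℝ) : ℝ :=
  ∑' I : L.lat, (I.1).indicator (fun _ => (MeasureTheory.volume I.1).toReal⁻¹ * a I.1) x

/-- `g` is in martingale BMO with constant `C`:
`(1/|I| ∫_I Σ_{J ∈ ℒ, J ⊆ I} |Δ_J g|²)^{1/2} ≤ C` and `‖Δ_I g‖_∞ ≤ C` for all `I ∈ ℒ`.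
(`‖g‖_BMO ≤ C` iff this holds.) -/
def IsBMOWith (g : ℝ → ℝ) (C : ℝ) : Prop :=
  (∀ I ∈ L.lat,
    ∫⁻ x in I, ∑' J : {J : Set ℝ // J ∈ L.lat ∧ J ⊆ I}, ENNReal.ofReal ((L.deltaI g J.1 x) ^ 2)
      ≤ ENNReal.ofReal (C ^ 2) * MeasureTheory.volume I) ∧
  ∀ I ∈ L.lat, ∀ᵐ x ∂MeasureTheory.volume, |L.deltaI g I x| ≤ C

/-- The truncated square function `S_k f = (Σ_{l ≤ k} |Δ_l f|²)^{1/2}`. -/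
def sqPart (f : ℝ → ℝ) (k : ℤ) (x : ℝ) : ℝ≥0∞ :=
  (∑' l : {l : ℤ // l ≤ k}, ENNReal.ofReal ((L.deltaK f l.1 x) ^ 2)) ^ (1 / 2 : ℝ)

/-- The square function `S'f = (Σ_{k ∈ ℤ} |Δ_k f|²)^{1/2}` (summed by generations). -/
def sqFull (f : ℝ → ℝ) (x : ℝ) : ℝ≥0∞ :=
  (∑' k : ℤ, ENNReal.ofReal ((L.deltaK f k x) ^ 2)) ^ (1 / 2 : ℝ)

end RLattice

theorem RLattice.laminar_aux (L : RLattice) (k : ℤ) (I : Set ℝ) (hI : I ∈ L.gen k) (n : ℕ) :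
    ∀ J ∈ L.gen (k + n), J ⊆ I ∨ Disjoint J I := by
  induction n with
  | zero =>
    intro J hJ
    simp only [Nat.cast_zero, add_zero] at hJ
    by_cases h : J = I
    · left; rw [h]
    · right; exact L.pairwise_disjoint k hJ hI h
  | succ n ih =>
    intro J hJ
    have hJ' : J ∈ L.gen (k + n + 1) := by
      rw [Nat.cast_succ, ← add_assoc] at hJ; exact hJ
    obtain ⟨p, q, hpq, rfl⟩ := L.isInterval _ J hJ'
    have hx : p ∈ ⋃₀ L.gen (k + n) := by rw [L.covers]; trivial
    obtain ⟨K, hK, hpK⟩ := hx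
    have hsub : Set.Ico p q ⊆ K := by
      rcases L.subdiv _ _ hJ' K hK with h | h
      · exact h
      · exact absurd hpK (Set.disjoint_left.mp h ⟨le_rfl, hpq⟩)
    rcases ih K hK with h | h
    · left; exact hsub.trans h
    · right; exact h.mono_left hsub

theorem RLattice.laminar (L : RLattice) {I J : Set ℝ} (hI : I ∈ L.lat) (hJ : J ∈ L.lat) :
    J ⊆ I ∨ I ⊆ J ∨ Disjoint J I := by
  obtain ⟨k, hk⟩ := hI
  obtain ⟨l, hl⟩ := hJ
  rcases le_total k l with h | h
  · obtain ⟨n, rfl⟩ := Int.le.dest h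
    rcases L.laminar_aux k I hk n J hl with h | h
    · exact Or.inl h
    · exact Or.inr (Or.inr h)
  · obtain ⟨n, rfl⟩ := Int.le.dest h
    rcases L.laminar_aux l J hl n I hk with h | h
    · exact Or.inr (Or.inl h)
    · exact Or.inr (Or.inr h.symm)

theorem RLattice.lat_meas (L : RLattice) {I : Set ℝ} (hI : I ∈ L.lat) : MeasurableSet I := by
  obtain ⟨k, hk⟩ := hI
  obtain ⟨p, q, _, rfl⟩ := L.isInterval k I hk
  exact measurableSet_Ico

theorem RLattice.carl_fin (L : RLattice) (a : Set ℝ → ℝ) (C : ℝ) (hCar : L.IsCarleson a C)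
    (n : ℕ) : ∀ G : Finset (Set ℝ), G.card ≤ n → (∀ I ∈ G, I ∈ L.lat) →
    ∑ I ∈ G, ENNReal.ofReal (a I) ≤ ENNReal.ofReal C * volume (⋃ I ∈ G, I) := by
  induction n with
  | zero =>
    intro G hG _
    have : G = ∅ := by simpa using hG
    subst this; simp
  | succ n ih =>
    intro G hG hlat
    rcases G.eq_empty_or_nonempty with rfl | hne
    · simp
    obtain ⟨T, hT⟩ := G.exists_maximal hne
    have hTG : T ∈ G := hT.prop
    rw [← Finset.sum_filter_add_sum_filter_not G (fun J => J ⊆ T)]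
    set R := G.filter (fun J => ¬ J ⊆ T) with hR
    have hRcard : R.card ≤ n := by
      have : R.card < G.card := by
        apply Finset.card_lt_card
        refine Finset.filter_ssubset.mpr ⟨T, hTG, ?_⟩
        simp
      omega
    have hRlat : ∀ I ∈ R, I ∈ L.lat := fun I hI => hlat I (Finset.mem_filter.mp hI).1
    have h2 := ih R hRcard hRlat
    have h1 : ∑ I ∈ G.filter (fun J => J ⊆ T), ENNReal.ofReal (a I)
        ≤ ENNReal.ofReal C * volume T := by
      refine le_trans ?_ (hCar T (Or.inl (hlat T hTG)))
      have := ENNReal.sum_le_tsum (f := fun J : {J : Set ℝ // J ∈ L.lat ∧ J ⊆ T} =>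
        ENNReal.ofReal (a J.1)) ((G.filter (fun J => J ⊆ T)).subtype _)
      refine le_trans (le_of_eq ?_) this
      rw [Finset.sum_subtype_of_mem (f := fun J => ENNReal.ofReal (a J))]
      intro x hx
      obtain ⟨hx1, hx2⟩ := Finset.mem_filter.mp hx
      exact ⟨hlat x hx1, hx2⟩
    have hdis : Disjoint T (⋃ I ∈ R, I) := by
      simp only [Set.disjoint_iUnion_right]
      intro J hJ
      obtain ⟨hJ1, hJ2⟩ := Finset.mem_filter.mp hJ
      rcases L.laminar (hlat T hTG) (hlat J hJ1) with h | h | h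
      · exact absurd h hJ2
      · exact absurd (hT.le_of_ge hJ1 h) hJ2
      · exact h.symm
    have hm : MeasurableSet (⋃ I ∈ R, I) :=
      Finset.measurableSet_biUnion _ fun I hI => L.lat_meas (hRlat I hI)
    calc _ ≤ ENNReal.ofReal C * volume T + ENNReal.ofReal C * volume (⋃ I ∈ R, I) :=
          add_le_add h1 h2
      _ = ENNReal.ofReal C * volume (T ∪ ⋃ I ∈ R, I) := by
          rw [measure_union hdis hm, mul_add]
      _ ≤ _ := by
          gcongr
          refine Set.union_subset ?_ ?_
          · exact Set.subset_biUnion_of_mem (u := fun I : Set ℝ => I) hTG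
          · exact Set.biUnion_subset_biUnion_left fun I hI => (Finset.mem_filter.mp hI).1

theorem RLattice.main_fin (L : RLattice) (f : ℝ → ℝ) (a : Set ℝ → ℝ) (C : ℝ)
    (hCar : L.IsCarleson (fun I => |a I|) C) (F : Finset (Set ℝ)) (hF : ∀ I ∈ F, I ∈ L.lat) :
    ∑ I ∈ F, ENNReal.ofReal (|avgOn f I| * |a I|)
      ≤ (∫⁻ x, L.maxFn f x) * ENNReal.ofReal C := by
  set c : Set ℝ → NNReal := fun I => Real.toNNReal |avgOn f I| with hc
  set g : ℝ → NNReal := fun x => F.sup fun I => I.indicator (fun _ => c I) x with hg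
  have hgm : Measurable g := by
    have : g = F.sup fun I => I.indicator (fun _ => c I) := by
      ext x; simp [hg, Finset.sup_apply]
    rw [this]
    exact Finset.sup_induction (p := fun h : ℝ → NNReal => Measurable h) measurable_const
      (fun _ h1 _ h2 => h1.sup h2)
      fun I hI => measurable_const.indicator (L.lat_meas (hF I hI))
  have hgle : ∀ x, (g x : ℝ≥0∞) ≤ L.maxFn f x := by
    intro x
    rcases F.eq_empty_or_nonempty with rfl | hne
    · simp [hg]
    obtain ⟨I, hI, hIe⟩ := Finset.exists_mem_eq_sup F hne fun I => I.indicator (fun _ => c I) x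
    have : g x = I.indicator (fun _ => c I) x := hIe
    rw [this]
    by_cases hx : x ∈ I
    · rw [Set.indicator_of_mem hx]
      exact le_iSup₂_of_le (f := fun (I : Set ℝ) (_ : I ∈ L.lat ∧ x ∈ I) =>
        ENNReal.ofReal |avgOn f I|) I ⟨hF I hI, hx⟩ le_rfl
    · rw [Set.indicator_of_notMem hx]; simp
  have hlc : ∫⁻ x, (g x : ℝ≥0∞) = ∫⁻ t in Set.Ioi (0:ℝ), volume {x | t < (g x : ℝ)} := by
    have := lintegral_eq_lintegral_meas_lt (volume : Measure ℝ) (f := fun x => (g x : ℝ))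
      (Filter.Eventually.of_forall fun x => (g x).2) hgm.coe_nnreal_real.aemeasurable
    simpa using this
  have hterm : ∀ I : Set ℝ, ENNReal.ofReal (|avgOn f I| * |a I|)
      = ∫⁻ t in Set.Ioi (0:ℝ), (Set.Iio |avgOn f I|).indicator
          (fun _ => ENNReal.ofReal |a I|) t := by
    intro I
    rw [lintegral_indicator measurableSet_Iio, lintegral_const,
      Measure.restrict_restrict measurableSet_Iio, Measure.restrict_apply_univ,
      Set.Iio_inter_Ioi, Real.volume_Ioo, sub_zero, mul_comm,
      ENNReal.ofReal_mul (abs_nonneg _)]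
  calc ∑ I ∈ F, ENNReal.ofReal (|avgOn f I| * |a I|)
      = ∫⁻ t in Set.Ioi (0:ℝ), ∑ I ∈ F, (Set.Iio |avgOn f I|).indicator
          (fun _ => ENNReal.ofReal |a I|) t := by
        rw [lintegral_finsetSum]
        · exact Finset.sum_congr rfl fun I _ => hterm I
        · intro I _; exact measurable_const.indicator measurableSet_Iio
    _ ≤ ∫⁻ t in Set.Ioi (0:ℝ), ENNReal.ofReal C * volume {x | t < (g x : ℝ)} := by
        refine lintegral_mono fun t => ?_
        have h1 : ∑ I ∈ F, (Set.Iio |avgOn f I|).indicator (fun _ => ENNReal.ofReal |a I|) t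
            = ∑ I ∈ F.filter (fun I => t < |avgOn f I|), ENNReal.ofReal |a I| := by
          rw [Finset.sum_filter]
          refine Finset.sum_congr rfl fun I _ => ?_
          simp only [Set.indicator_apply, Set.mem_Iio]
        show ∑ I ∈ F, (Set.Iio |avgOn f I|).indicator (fun _ => ENNReal.ofReal |a I|) t ≤ _
        rw [h1]
        refine (L.carl_fin _ C hCar _ _ le_rfl
          fun I hI => hF I (Finset.mem_filter.mp hI).1).trans ?_
        gcongr
        refine Set.iUnion₂_subset fun I hI x hx => ?_
        obtain ⟨hI1, hI2⟩ := Finset.mem_filter.mp hI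
        have h3 : c I ≤ g x := by
          have := Finset.le_sup (f := fun I : Set ℝ => I.indicator (fun _ => c I) x) hI1
          simpa [Set.indicator_of_mem hx] using this
        have h4 : (c I : ℝ) = |avgOn f I| := Real.coe_toNNReal _ (abs_nonneg _)
        have h5 : (c I : ℝ) ≤ g x := h3
        show t < (g x : ℝ)
        linarith
    _ = ENNReal.ofReal C * ∫⁻ x, (g x : ℝ≥0∞) := by
        rw [lintegral_const_mul' _ _ ENNReal.ofReal_ne_top, hlc]
    _ ≤ (∫⁻ x, L.maxFn f x) * ENNReal.ofReal C := by
        rw [mul_comm]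
        gcongr with x
        exact hgle x

/-- if `f` is `𝔄_∞`-measurable with `Mf ∈ L¹` and `(|a_I|)` is Carleson with
constant `C`, then `Σ_I |⟨f⟩_I||a_I| ≤ ‖Mf‖₁·C`; in particular `Σ_I ⟨f⟩_I a_I` converges
absolutely and `|Σ_I ⟨f⟩_I a_I| ≤ ‖f‖_{H¹_*}·C`. -/
theorem stmt9 (L : RLattice) (f : ℝ → ℝ) (a : Set ℝ → ℝ) (C : ℝ) (hC : 0 < C)
    (hfm : L.AInfMeasurable f) (hMf : (∫⁻ x, L.maxFn f x) < ⊤)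
    (hCar : L.IsCarleson (fun I => |a I|) C) :
    (∑' I : L.lat, ENNReal.ofReal (|avgOn f I.1| * |a I.1|)
        ≤ (∫⁻ x, L.maxFn f x) * ENNReal.ofReal C) ∧
    Summable (fun I : L.lat => avgOn f I.1 * a I.1) ∧
    |∑' I : L.lat, avgOn f I.1 * a I.1| ≤ (∫⁻ x, L.maxFn f x).toReal * C := by
  have h1 : ∑' I : L.lat, ENNReal.ofReal (|avgOn f I.1| * |a I.1|)
        ≤ (∫⁻ x, L.maxFn f x) * ENNReal.ofReal C := by
    rw [ENNReal.tsum_eq_iSup_sum]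
    refine iSup_le fun s => ?_
    have := L.main_fin f a C hCar (s.map (Function.Embedding.subtype _)) (by
      intro I hI
      obtain ⟨J, _, rfl⟩ := Finset.mem_map.mp hI
      exact J.2)
    simpa using this
  have hfin : (∫⁻ x, L.maxFn f x) * ENNReal.ofReal C ≠ ⊤ :=
    ENNReal.mul_ne_top hMf.ne ENNReal.ofReal_ne_top
  have hs : Summable (fun I : L.lat => |avgOn f I.1 * a I.1|) := by
    have := ENNReal.summable_toReal (ne_top_of_le_ne_top hfin h1)
    refine this.congr fun I => ?_
    rw [ENNReal.toReal_ofReal (by positivity), abs_mul]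
  refine ⟨h1, hs.of_abs, ?_⟩
  have h2 : |∑' I : L.lat, avgOn f I.1 * a I.1| ≤ ∑' I : L.lat, |avgOn f I.1 * a I.1| := by
    simpa [Real.norm_eq_abs] using norm_tsum_le_tsum_norm (f := fun I : L.lat =>
      avgOn f I.1 * a I.1) (by simpa [Real.norm_eq_abs] using hs)
  refine h2.trans ?_
  have h3 := ENNReal.toReal_mono hfin h1
  rw [ENNReal.toReal_mul, ENNReal.toReal_ofReal hC.le,
    ENNReal.tsum_toReal_eq fun _ => ENNReal.ofReal_ne_top] at h3
  refine le_trans (le_of_eq (tsum_congr fun I => ?_)) h3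
  rw [ENNReal.toReal_ofReal (by positivity), abs_mul]

end
end

section
/- (Herz's estimate) Let ℒ be a lattice on ℝ and let f be locally integrable. Define Δ_k f = E_k f − E_{k−1} f, S_k f = (Σ_{l≤k} |Δ_l f|²)^{1/2}, and S'f = (Σ_{k∈ℤ} |Δ_k f|²)^{1/2}. Then Σ_{k∈ℤ} ∫_ℝ |Δ_k f|² / S_k f ≤ 2 ∫_ℝ S'f, where the integrand is interpreted as 0 on the set where S_k f = 0. -/
open MeasureTheory Set Filter
open scoped ENNReal Topology Classical

noncomputable section

/-- Sub-additivity in the form needed: no measurability is required. -/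
lemma tsum_lintegral_le_lintegral_tsum (g : ℤ → ℝ → ℝ≥0∞) :
    ∑' k : ℤ, ∫⁻ x, g k x ≤ ∫⁻ x, ∑' k : ℤ, g k x := by
  rw [ENNReal.tsum_eq_iSup_sum]
  refine iSup_le fun s => ?_
  have h : ∑ k ∈ s, ∫⁻ x, g k x ≤ ∫⁻ x, ∑ k ∈ s, g k x := by
    induction s using Finset.induction_on with
    | empty => simp
    | insert a s ha ih =>
      simp only [Finset.sum_insert ha]
      exact (add_le_add le_rfl ih).trans (le_lintegral_add _ _)
  exact h.trans (lintegral_mono fun x => ENNReal.sum_le_tsum s)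

/-- One telescoping step. -/
lemma herz_step (a c : ℝ≥0∞) :
    a / (a + c) ^ (1 / 2 : ℝ) + 2 * c ^ (1 / 2 : ℝ) ≤ 2 * (a + c) ^ (1 / 2 : ℝ) := by
  by_cases ht : a + c = ⊤
  · simp [ht]
  by_cases h0 : a + c = 0
  · obtain ⟨rfl, rfl⟩ := add_eq_zero.1 h0
    simp
  have hS : ((a + c) ^ (1 / 2 : ℝ)) ^ 2 = a + c := by
    rw [← ENNReal.rpow_natCast, ← ENNReal.rpow_mul]; norm_num
  have hR : (c ^ (1 / 2 : ℝ)) ^ 2 = c := by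
    rw [← ENNReal.rpow_natCast, ← ENNReal.rpow_mul]; norm_num
  have hrs : c ^ (1 / 2 : ℝ) ≤ (a + c) ^ (1 / 2 : ℝ) :=
    ENNReal.rpow_le_rpow le_add_self (by norm_num)
  have hs0 : (a + c) ^ (1 / 2 : ℝ) ≠ 0 := by
    intro h; rw [h] at hS; exact h0 (by rw [← hS]; simp)
  have hst : (a + c) ^ (1 / 2 : ℝ) ≠ ⊤ := ENNReal.rpow_ne_top_of_nonneg (by norm_num) ht
  have hrt := ne_top_of_le_ne_top hst hrs
  have hat : a ≠ ⊤ := fun h => ht (by simp [h])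
  have hct : c ≠ ⊤ := fun h => ht (by simp [h])
  generalize (a + c) ^ (1 / 2 : ℝ) = s at *
  generalize c ^ (1 / 2 : ℝ) = r at *
  lift s to NNReal using hst
  lift r to NNReal using hrt
  lift a to NNReal using hat
  lift c to NNReal using hct
  norm_cast at *
  have hs : s ≠ 0 := hs0
  rw [← ENNReal.coe_div hs]
  norm_cast
  rw [← NNReal.coe_le_coe]
  have h1 : (s : ℝ) ^ 2 = a + c := by exact_mod_cast hS
  have h2 : (r : ℝ) ^ 2 = c := by exact_mod_cast hR
  have hsp : (0 : ℝ) < s := by exact_mod_cast pos_iff_ne_zero.2 hs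
  push_cast
  rw [← sub_nonneg]
  have : (2 * s - (a / s + 2 * r) : ℝ) = (s - r) ^ 2 / s := by
    have ha : (a : ℝ) = s ^ 2 - r ^ 2 := by linarith
    rw [ha]; field_simp; ring
  rw [this]; positivity

lemma herz_pointwise (a : ℤ → ℝ≥0∞) (s : Finset ℤ) :
    ∀ k, (∀ x ∈ s, x ≤ k) →
    ∑ j ∈ s, a j / (∑' l : {l : ℤ // l ≤ j}, a l.1) ^ (1 / 2 : ℝ)
      ≤ 2 * (∑' l : {l : ℤ // l ≤ k}, a l.1) ^ (1 / 2 : ℝ) := by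
  have hrec : ∀ j, ∑' l : {l : ℤ // l ≤ j}, a l.1
      = a j + ∑' l : {l : ℤ // l ≤ j - 1}, a l.1 := by
    intro j
    have hu : Iic j = {j} ∪ Iic (j - 1) := by
      ext x; simp only [mem_Iic, mem_union, mem_singleton_iff]; omega
    have hd : Disjoint ({j} : Set ℤ) (Iic (j - 1)) := by simp
    have h := ENNReal.summable.tsum_union_disjoint (f := a) hd ENNReal.summable
    rw [← hu, tsum_singleton] at h
    exact h
  have hmono : ∀ i j : ℤ, i ≤ j → ∑' l : {l : ℤ // l ≤ i}, a l.1
      ≤ ∑' l : {l : ℤ // l ≤ j}, a l.1 := fun i j hij =>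
    ENNReal.tsum_mono_subtype a (s := Iic i) (t := Iic j) (Iic_subset_Iic.2 hij)
  induction s using Finset.induction_on_max with
  | empty => simp
  | insert m s hm ih =>
    intro k hk
    rw [Finset.sum_insert (fun h => lt_irrefl _ (hm m h))]
    have hmk : m ≤ k := hk m (Finset.mem_insert_self _ _)
    calc _ ≤ _ := add_le_add le_rfl (ih (m - 1) fun x hx => by have := hm x hx; omega)
      _ ≤ 2 * (∑' l : {l : ℤ // l ≤ m}, a l.1) ^ (1 / 2 : ℝ) := by
        rw [hrec m]; exact herz_step _ _
      _ ≤ _ := by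
        gcongr
        exact hmono m k hmk

/-- Herz's estimate: `Σ_k ∫ |Δ_k f|²/S_k f ≤ 2∫ S'f` (in `[0,∞]`, where
`0/0 = 0`, so the integrand is `0` on `{S_k f = 0}`). -/
theorem stmt13 (L : RLattice) (f : ℝ → ℝ)
    (hf : MeasureTheory.LocallyIntegrable f MeasureTheory.volume) :
    ∑' k : ℤ, ∫⁻ x, ENNReal.ofReal ((L.deltaK f k x) ^ 2) / L.sqPart f k x
      ≤ 2 * ∫⁻ x, L.sqFull f x := by
  refine (tsum_lintegral_le_lintegral_tsum _).trans ?_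
  rw [← lintegral_const_mul' _ _ (by norm_num)]
  refine lintegral_mono fun x => ?_
  simp only [RLattice.sqPart, RLattice.sqFull]
  rw [ENNReal.tsum_eq_iSup_sum]
  refine iSup_le fun s => ?_
  obtain ⟨k, hk⟩ := s.bddAbove
  refine (herz_pointwise (fun k => ENNReal.ofReal ((L.deltaK f k x) ^ 2)) s k
    fun y hy => hk hy).trans ?_
  gcongr
  exact ENNReal.tsum_comp_le_tsum_of_injective Subtype.val_injective _

end
end

section
/- Let ℒ be a lattice on ℝ, let f be locally integrable, and let g be in martingale BMO. Define Δ_k f = E_k f − E_{k−1} f, S_k f = (Σ_{l≤k} |Δ_l f|²)^{1/2}, and S'f = (Σ_{k∈ℤ} |Δ_k f|²)^{1/2}. Then for every n ∈ ℤ, Σ_{k≤n} ∫_ℝ |Δ_k g|² S_k f ≤ 2 ‖g‖²_BMO ∫_ℝ S'f. -/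
open MeasureTheory Set Filter
open scoped ENNReal Topology Classical

noncomputable section

namespace RLattice

theorem exP (L : RLattice) (k : ℤ) (x : ℝ) : ∃ I, I ∈ L.gen k ∧ x ∈ I := by
  have h : x ∈ ⋃₀ L.gen k := by rw [L.covers]; trivial
  obtain ⟨I, hI, hx⟩ := h
  exact ⟨I, hI, hx⟩

/-- The interval of generation `k` containing `x`. -/
def P (L : RLattice) (k : ℤ) (x : ℝ) : Set ℝ := (L.exP k x).choose

theorem P_mem (L : RLattice) (k : ℤ) (x : ℝ) : L.P k x ∈ L.gen k := (L.exP k x).choose_spec.1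

theorem mem_P (L : RLattice) (k : ℤ) (x : ℝ) : x ∈ L.P k x := (L.exP k x).choose_spec.2

theorem P_eq (L : RLattice) {k : ℤ} {x : ℝ} {I : Set ℝ} (hI : I ∈ L.gen k) (hx : x ∈ I) :
    L.P k x = I := by
  by_contra hne
  have := L.pairwise_disjoint k (L.P_mem k x) hI hne
  exact Set.disjoint_left.1 this (L.mem_P k x) hx

theorem P_succ (L : RLattice) (k : ℤ) (x : ℝ) : L.P (k + 1) x ⊆ L.P k x := by
  rcases L.subdiv k _ (L.P_mem (k + 1) x) _ (L.P_mem k x) with h | h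
  · exact h
  · exact absurd (L.mem_P k x) (Set.disjoint_left.1 h (L.mem_P (k + 1) x))

theorem P_anti (L : RLattice) {l k : ℤ} (h : l ≤ k) (x : ℝ) : L.P k x ⊆ L.P l x := by
  induction k, h using Int.le_induction with
  | base => exact subset_rfl
  | succ k _ ih => exact (L.P_succ k x).trans ih

theorem gen_nonempty (L : RLattice) {k : ℤ} {I : Set ℝ} (hI : I ∈ L.gen k) : I.Nonempty := by
  obtain ⟨a, b, hab, rfl⟩ := L.isInterval k I hI
  exact ⟨a, by simp [hab]⟩

theorem gen_meas (L : RLattice) {k : ℤ} {I : Set ℝ} (hI : I ∈ L.gen k) : MeasurableSet I := by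
  obtain ⟨a, b, hab, rfl⟩ := L.isInterval k I hI
  exact measurableSet_Ico

theorem gen_countable (L : RLattice) (k : ℤ) : (L.gen k).Countable := by
  refine (L.pairwise_disjoint k).countable_of_nonempty_interior ?_
  intro I hI
  obtain ⟨a, b, hab, rfl⟩ := L.isInterval k I hI
  simp [interior_Ico, hab]

theorem lat_countable (L : RLattice) : L.lat.Countable := by
  have : L.lat = ⋃ k, L.gen k := by ext; simp [lat]
  rw [this]
  exact Set.countable_iUnion L.gen_countable

theorem Ek_eq (L : RLattice) (f : ℝ → ℝ) (k : ℤ) (x : ℝ) :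
    L.Ek f k x = avgOn f (L.P k x) := by
  unfold Ek
  rw [tsum_eq_single (⟨L.P k x, L.P_mem k x⟩ : L.gen k)]
  · simp [avgInd, L.mem_P]
  · intro I hI
    unfold avgInd
    rw [Set.indicator_of_notMem]
    intro hx
    exact hI (Subtype.ext (L.P_eq I.2 hx).symm)

theorem rank_le (L : RLattice) {J : Set ℝ} {k k' : ℤ} (h1 : J ∈ L.gen k)
    (h2 : J ∉ L.gen (k + 1)) (h3 : J ∈ L.gen k') : k' ≤ k := by
  by_contra! hlt
  obtain ⟨x, hx⟩ := L.gen_nonempty h1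
  have e1 := L.P_eq h1 hx
  have e2 := L.P_eq h3 hx
  have a1 := L.P_succ k x
  have a2 := L.P_anti (show k + 1 ≤ k' by omega) x
  rw [e1] at a1
  rw [e2] at a2
  exact h2 (a1.antisymm a2 ▸ L.P_mem (k + 1) x)

theorem deltaI_P (L : RLattice) (g : ℝ → ℝ) (k : ℤ) (x : ℝ)
    (h : L.P (k - 1) x ∉ L.gen k) : L.deltaI g (L.P (k - 1) x) x = L.deltaK g k x := by
  have hm : L.P k x ∈ L.children (L.P (k - 1) x) := by
    refine ⟨k - 1, L.P_mem _ x, ?_, ?_, L.P_anti (by omega) x⟩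
    · simpa using h
    · simpa using L.P_mem k x
  unfold deltaI deltaK
  rw [if_pos ⟨_, hm⟩, Ek_eq, Ek_eq, tsum_eq_single (⟨L.P k x, hm⟩ : L.children (L.P (k - 1) x))]
  · simp [avgInd, L.mem_P]
  · intro J hJ
    unfold avgInd
    rw [Set.indicator_of_notMem]
    intro hx
    obtain ⟨j, h1, h2, h3, h4⟩ := J.2
    have hk : j = k - 1 := by
      apply le_antisymm
      · exact L.rank_le (L.P_mem (k - 1) x) (by simpa using h) h1
      · exact L.rank_le h1 h2 (L.P_mem (k - 1) x)
    subst hk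
    have h3' : J.1 ∈ L.gen k := by simpa using h3
    exact hJ (Subtype.ext (L.P_eq h3' hx).symm)

theorem deltaK_zero (L : RLattice) (g : ℝ → ℝ) (k : ℤ) (x : ℝ)
    (h : L.P (k - 1) x ∈ L.gen k) : L.deltaK g k x = 0 := by
  unfold deltaK
  rw [Ek_eq, Ek_eq, L.P_eq h (L.mem_P _ x), sub_self]

/-- `h` is constant on the intervals of generation `k`. -/
def Cst (L : RLattice) (k : ℤ) (h : ℝ → ℝ≥0∞) : Prop :=
  ∀ x y, L.P k x = L.P k y → h x = h y

theorem Cst.meas {L : RLattice} {k : ℤ} {h : ℝ → ℝ≥0∞} (hh : L.Cst k h) : Measurable h := by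
  intro s _
  have : h ⁻¹' s = ⋃ I ∈ {I | I ∈ L.gen k ∧ ∃ x ∈ I, h x ∈ s}, I := by
    ext y
    simp only [mem_preimage, mem_setOf_eq, mem_iUnion, exists_prop]
    constructor
    · intro hy
      exact ⟨L.P k y, ⟨L.P_mem k y, y, L.mem_P k y, hy⟩, L.mem_P k y⟩
    · rintro ⟨I, ⟨hI, x, hx, hxs⟩, hy⟩
      rwa [hh y x ((L.P_eq hI hy).trans (L.P_eq hI hx).symm)]
  rw [this]
  refine MeasurableSet.biUnion ((L.gen_countable k).mono fun I hI => hI.1) ?_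
  intro I hI
  exact L.gen_meas hI.1

theorem P_eq_of_le (L : RLattice) {l k : ℤ} (h : l ≤ k) {x y : ℝ} (e : L.P k x = L.P k y) :
    L.P l x = L.P l y := by
  refine L.P_eq (L.P_mem l y) ?_
  exact L.P_anti h y (e ▸ L.mem_P k x)

theorem deltaK_cst (L : RLattice) (g : ℝ → ℝ) {l k : ℤ} (h : l ≤ k) {x y : ℝ}
    (e : L.P k x = L.P k y) : L.deltaK g l x = L.deltaK g l y := by
  unfold deltaK
  rw [Ek_eq, Ek_eq, Ek_eq, Ek_eq, L.P_eq_of_le h e, L.P_eq_of_le (show l - 1 ≤ k by omega) e]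

/-- squared difference -/
def sqD (L : RLattice) (g : ℝ → ℝ) (k : ℤ) (x : ℝ) : ℝ≥0∞ := ENNReal.ofReal ((L.deltaK g k x) ^ 2)

/-- tail of the squared differences -/
def tl (L : RLattice) (g : ℝ → ℝ) (k : ℤ) (x : ℝ) : ℝ≥0∞ := ∑' j : ℕ, L.sqD g (k + j) x

theorem sqD_meas (L : RLattice) (g : ℝ → ℝ) (k : ℤ) : Measurable (L.sqD g k) := by
  refine Cst.meas (L := L) (k := k) ?_
  intro x y e
  unfold sqD
  rw [L.deltaK_cst g le_rfl e]

theorem tl_meas (L : RLattice) (g : ℝ → ℝ) (k : ℤ) : Measurable (L.tl g k) :=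
  Measurable.ennreal_tsum fun j => L.sqD_meas g (k + j)

theorem tl_succ (L : RLattice) (g : ℝ → ℝ) (k : ℤ) (x : ℝ) :
    L.tl g k x = L.sqD g k x + L.tl g (k + 1) x := by
  unfold tl
  rw [tsum_eq_zero_add' ENNReal.summable]
  congr 1
  · simp
  · congr 1
    ext j
    congr 1
    push_cast
    ring

theorem sqPart_cst (L : RLattice) (f : ℝ → ℝ) {l k : ℤ} (h : l ≤ k) : L.Cst k (L.sqPart f l) := by
  intro x y e
  unfold sqPart
  congr 1
  congr 1
  ext j
  rw [L.deltaK_cst f (j.2.trans h) e]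

theorem sqPart_mono (L : RLattice) (f : ℝ → ℝ) {l k : ℤ} (h : l ≤ k) (x : ℝ) :
    L.sqPart f l x ≤ L.sqPart f k x := by
  unfold sqPart
  refine ENNReal.rpow_le_rpow ?_ (by norm_num)
  exact ENNReal.tsum_mono_subtype (fun l => ENNReal.ofReal ((L.deltaK f l x) ^ 2))
    (s := {j | j ≤ l}) (t := {j | j ≤ k}) (fun j hj => le_trans hj h)

theorem sqPart_le_full (L : RLattice) (f : ℝ → ℝ) (k : ℤ) (x : ℝ) :
    L.sqPart f k x ≤ L.sqFull f x := by
  unfold sqPart sqFull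
  refine ENNReal.rpow_le_rpow ?_ (by norm_num)
  exact ENNReal.tsum_comp_le_tsum_of_injective (f := fun l : {l : ℤ // l ≤ k} => l.1)
    Subtype.val_injective (fun l => ENNReal.ofReal ((L.deltaK f l x) ^ 2))

theorem tl_le (L : RLattice) (g : ℝ → ℝ) {k : ℤ} {I : Set ℝ} (hI : I ∈ L.gen k) {x : ℝ}
    (hx : x ∈ I) : L.tl g (k + 1) x ≤
      ∑' J : {J : Set ℝ // J ∈ L.lat ∧ J ⊆ I}, ENNReal.ofReal ((L.deltaI g J.1 x) ^ 2) := by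
  unfold tl
  let s : Set ℕ := {j | L.P (k + j) x ∉ L.gen (k + 1 + j)}
  have e0 : ∀ j : ℕ, k + 1 + (j : ℤ) - 1 = k + j := fun j => by ring
  have hs : Function.support (fun j : ℕ => L.sqD g (k + 1 + j) x) ⊆ s := by
    intro j hj hmem
    apply hj
    have := L.deltaK_zero g (k + 1 + j) x (by rw [e0]; exact hmem)
    simp [sqD, this]
  rw [← tsum_subtype_eq_of_support_subset hs]
  let φ : s → {J : Set ℝ // J ∈ L.lat ∧ J ⊆ I} := fun j =>
    ⟨L.P (k + (j.1 : ℤ)) x, ⟨_, L.P_mem _ x⟩, by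
      have := L.P_anti (show k ≤ k + (j.1 : ℤ) by omega) x
      rwa [L.P_eq hI hx] at this⟩
  have hφ : Function.Injective φ := by
    intro i j hij
    have hij' : L.P (k + (i.1 : ℤ)) x = L.P (k + (j.1 : ℤ)) x := congrArg Subtype.val hij
    have e1 : ∀ j : ℕ, k + (j : ℤ) + 1 = k + 1 + j := fun j => by ring
    have h1 := L.rank_le (L.P_mem (k + (i.1 : ℤ)) x) (by rw [e1]; exact i.2)
      (hij' ▸ L.P_mem (k + (j.1 : ℤ)) x)
    have h2 := L.rank_le (L.P_mem (k + (j.1 : ℤ)) x) (by rw [e1]; exact j.2)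
      (hij' ▸ L.P_mem (k + (i.1 : ℤ)) x)
    apply Subtype.ext
    omega
  refine le_trans (le_of_eq ?_) (ENNReal.tsum_comp_le_tsum_of_injective hφ
    (fun J => ENNReal.ofReal ((L.deltaI g J.1 x) ^ 2)))
  refine tsum_congr fun j => ?_
  have := L.deltaI_P g (k + 1 + (j.1 : ℤ)) x (by rw [e0]; exact j.2)
  rw [e0] at this
  simp only [φ, this, sqD]

theorem lintegral_tl (L : RLattice) (g : ℝ → ℝ) (B : ℝ) (hgB : L.IsBMOWith g B) (k : ℤ)
    (h : ℝ → ℝ≥0∞) (hh : L.Cst k h) :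
    ∫⁻ x, L.tl g (k + 1) x * h x ≤ ENNReal.ofReal (B ^ 2) * ∫⁻ x, h x := by
  haveI : Countable (L.gen k) := (L.gen_countable k).to_subtype
  have hU : (⋃ I : L.gen k, I.1) = Set.univ := by rw [← Set.sUnion_eq_iUnion, L.covers]
  have hd : Pairwise (Function.onFun Disjoint fun I : L.gen k => I.1) := by
    intro I J hIJ
    exact L.pairwise_disjoint k I.2 J.2 (fun e => hIJ (Subtype.ext e))
  have key : ∀ F : ℝ → ℝ≥0∞, ∫⁻ x, F x = ∑' I : L.gen k, ∫⁻ x in I.1, F x := by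
    intro F
    rw [← lintegral_iUnion (fun I => L.gen_meas I.2) hd, hU, setLIntegral_univ]
  rw [key, key h, ← ENNReal.tsum_mul_left]
  refine ENNReal.tsum_le_tsum fun I => ?_
  obtain ⟨y, hy⟩ := L.gen_nonempty I.2
  have hc : ∀ x ∈ I.1, h x = h y := fun x hx =>
    hh x y ((L.P_eq I.2 hx).trans (L.P_eq I.2 hy).symm)
  have e1 : ∫⁻ x in I.1, L.tl g (k + 1) x * h x = (∫⁻ x in I.1, L.tl g (k + 1) x) * h y := by
    rw [← lintegral_mul_const _ (L.tl_meas g (k + 1))]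
    refine setLIntegral_congr_fun (L.gen_meas I.2) ?_
    intro x hx
    simp only [hc x hx]
  have e2 : ∫⁻ x in I.1, h x = h y * volume I.1 := by
    rw [← setLIntegral_const]
    exact setLIntegral_congr_fun (L.gen_meas I.2) hc
  have e3 : ∫⁻ x in I.1, L.tl g (k + 1) x ≤ ENNReal.ofReal (B ^ 2) * volume I.1 := by
    refine le_trans ?_ (hgB.1 I.1 ⟨k, I.2⟩)
    exact setLIntegral_mono' (L.gen_meas I.2) fun x hx => L.tl_le g I.2 hx
  rw [e1, e2]
  calc _ ≤ ENNReal.ofReal (B ^ 2) * volume I.1 * h y := by gcongr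
    _ = _ := by ring

theorem sqD_le (L : RLattice) (g : ℝ → ℝ) (B : ℝ) (hgB : L.IsBMOWith g B) (k : ℤ) :
    ∀ᵐ x ∂(volume : Measure ℝ), L.sqD g k x ≤ ENNReal.ofReal (B ^ 2) := by
  have : ∀ᵐ x ∂(volume : Measure ℝ), ∀ I ∈ L.lat, |L.deltaI g I x| ≤ B :=
    (ae_ball_iff L.lat_countable).2 hgB.2
  filter_upwards [this] with x hx
  unfold sqD
  by_cases h : L.P (k - 1) x ∈ L.gen k
  · simp [L.deltaK_zero g k x h]
  · rw [← L.deltaI_P g k x h]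
    refine ENNReal.ofReal_le_ofReal ?_
    have := hx _ ⟨k - 1, L.P_mem (k - 1) x⟩
    exact sq_le_sq' (abs_le.1 this).1 (abs_le.1 this).2

theorem lintegral_tl' (L : RLattice) (g : ℝ → ℝ) (B : ℝ) (hgB : L.IsBMOWith g B) (k : ℤ)
    (h : ℝ → ℝ≥0∞) (hh : L.Cst k h) :
    ∫⁻ x, L.tl g k x * h x ≤ 2 * ENNReal.ofReal (B ^ 2) * ∫⁻ x, h x := by
  have e : ∀ x, L.tl g k x * h x = L.sqD g k x * h x + L.tl g (k + 1) x * h x := fun x => by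
    rw [tl_succ, add_mul]
  simp_rw [e]
  rw [lintegral_add_left (show Measurable fun x => L.sqD g k x * h x from (L.sqD_meas g k).mul hh.meas)]
  have h1 : ∫⁻ x, L.sqD g k x * h x ≤ ENNReal.ofReal (B ^ 2) * ∫⁻ x, h x := by
    rw [← lintegral_const_mul _ hh.meas]
    refine lintegral_mono_ae ?_
    filter_upwards [L.sqD_le g B hgB k] with x hx
    gcongr
  calc _ ≤ _ := add_le_add h1 (L.lintegral_tl g B hgB k h hh)
    _ = _ := by ring

theorem main_ind (L : RLattice) (f g : ℝ → ℝ) (B : ℝ) (hgB : L.IsBMOWith g B) (m : ℤ) (N : ℕ) :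
    (∑ j ∈ Finset.range N, ∫⁻ x, L.sqD g (m + 1 + j) x * L.sqPart f (m + 1 + j) x)
      + ∫⁻ x, L.tl g (m + N + 1) x * L.sqPart f (m + N) x
      ≤ 2 * ENNReal.ofReal (B ^ 2) * ∫⁻ x, L.sqPart f (m + N) x := by
  induction N with
  | zero =>
    simp only [Finset.range_zero, Finset.sum_empty, zero_add]
    refine (L.lintegral_tl g B hgB _ _ (L.sqPart_cst f le_rfl)).trans ?_
    gcongr
    exact le_mul_of_one_le_left zero_le (by norm_num)
  | succ N ih =>
    rw [Finset.sum_range_succ]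
    have ek : m + ((N + 1 : ℕ) : ℤ) = m + N + 1 := by push_cast; ring
    have ek' : m + 1 + (N : ℤ) = m + N + 1 := by ring
    rw [ek, ek']
    generalize m + (N : ℤ) = p at ih ⊢
    let d : ℝ → ℝ≥0∞ := fun x => L.sqPart f (p + 1) x - L.sqPart f p x
    have hd : L.Cst (p + 1) d := by
      intro x y e
      simp only [d]
      rw [L.sqPart_cst f le_rfl x y e, L.sqPart_cst f (show p ≤ p + 1 by omega) x y e]
    have hS : ∀ x, L.sqPart f (p + 1) x = L.sqPart f p x + d x := fun x =>
      (add_tsub_cancel_of_le (L.sqPart_mono f (by omega) x)).symm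
    have hmS : ∀ q, Measurable (L.sqPart f q) := fun q => (L.sqPart_cst f le_rfl).meas
    have s1 : ∫⁻ x, L.sqPart f (p + 1) x = (∫⁻ x, L.sqPart f p x) + ∫⁻ x, d x := by
      rw [← lintegral_add_left (hmS p)]
      exact lintegral_congr hS
    have s2 : (∫⁻ x, L.sqD g (p + 1) x * L.sqPart f (p + 1) x)
        + ∫⁻ x, L.tl g (p + 1 + 1) x * L.sqPart f (p + 1) x
        = (∫⁻ x, L.tl g (p + 1) x * L.sqPart f p x) + ∫⁻ x, L.tl g (p + 1) x * d x := by
      rw [← lintegral_add_left (show Measurable fun x => L.sqD g (p + 1) x * L.sqPart f (p + 1) x from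
          (L.sqD_meas g _).mul (hmS _)),
        ← lintegral_add_left (show Measurable fun x => L.tl g (p + 1) x * L.sqPart f p x from
          (L.tl_meas g _).mul (hmS _))]
      refine lintegral_congr fun x => ?_
      rw [← add_mul, ← tl_succ, hS x, mul_add]
    rw [add_assoc, s2, ← add_assoc, s1, mul_add]
    exact add_le_add ih (L.lintegral_tl' g B hgB (p + 1) d hd)

end RLattice

/-- for `g` in martingale BMO with `‖g‖_BMO ≤ B` and every `n ∈ ℤ`,
`Σ_{k ≤ n} ∫ |Δ_k g|² S_k f ≤ 2B²∫ S'f`. -/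
theorem stmt14 (L : RLattice) (f g : ℝ → ℝ) (B : ℝ) (hB : 0 ≤ B)
    (hf : MeasureTheory.LocallyIntegrable f MeasureTheory.volume)
    (hg : MeasureTheory.LocallyIntegrable g MeasureTheory.volume)
    (hgB : L.IsBMOWith g B) (n : ℤ) :
    ∑' k : {k : ℤ // k ≤ n},
        ∫⁻ x, ENNReal.ofReal ((L.deltaK g k.1 x) ^ 2) * L.sqPart f k.1 x
      ≤ 2 * ENNReal.ofReal (B ^ 2) * ∫⁻ x, L.sqFull f x := by
  let F : ℤ → ℝ≥0∞ := fun k => ∫⁻ x, L.sqD g k x * L.sqPart f k x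
  change ∑' k : {k : ℤ // k ≤ n}, F k.1 ≤ _
  let φ : ℕ → {k : ℤ // k ≤ n} := fun j => ⟨n - j, by omega⟩
  have hφ : Function.Surjective φ := by
    rintro ⟨k, hk⟩
    refine ⟨(n - k).toNat, Subtype.ext ?_⟩
    simp only [φ]
    omega
  refine (ENNReal.tsum_le_tsum_comp_of_surjective hφ (fun k => F k.1)).trans ?_
  rw [ENNReal.tsum_eq_iSup_nat]
  refine iSup_le fun N => ?_
  rw [← Finset.sum_range_reflect]
  have e : ∑ j ∈ Finset.range N, F (φ (N - 1 - j)).1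
      = ∑ j ∈ Finset.range N, F ((n - N) + 1 + j) := by
    refine Finset.sum_congr rfl fun j hj => ?_
    have := Finset.mem_range.1 hj
    congr 1
    simp only [φ]
    omega
  rw [e]
  refine le_trans (le_trans le_self_add (L.main_ind f g B hgB (n - N) N)) ?_
  gcongr with x
  exact L.sqPart_le_full f _ x

end
end

section
/- Let ℒ be a lattice on ℝ, let f be locally integrable, let (a_I)_{I∈ℒ} be real numbers with (|a_I|)_{I∈ℒ} a Carleson sequence, let ε > 0, and set E_k = {x ∈ ℝ : Mf(x) > (1+ε)^k} for k ∈ ℤ. Then Σ_{I∈ℒ} |⟨f⟩_I| |a_I| ≤ ε Σ_{k∈ℤ} (1+ε)^k |E_k| · Carl(|a_I|), where |E_k| denotes the Lebesgue measure of E_k. -/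
open MeasureTheory Set Filter
open scoped ENNReal Topology Classical

noncomputable section

theorem RLattice.nested_aux (L : RLattice) (k : ℤ) (J : Set ℝ) (hJ : J ∈ L.gen k) (n : ℕ) :
    ∀ I ∈ L.gen (k + n), I ⊆ J ∨ Disjoint I J := by
  induction n with
  | zero =>
    intro I hI
    simp only [Nat.cast_zero, add_zero] at hI
    by_cases h : I = J
    · left; rw [h]
    · right; exact L.pairwise_disjoint k hI hJ h
  | succ n ih =>
    intro I hI
    have e : k + ((n + 1 : ℕ) : ℤ) = (k + n) + 1 := by push_cast; ring
    rw [e] at hI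
    obtain ⟨p, q, hpq, hE⟩ := L.isInterval _ I hI
    have hx : p ∈ I := by rw [hE]; exact ⟨le_rfl, hpq⟩
    have hc : p ∈ ⋃₀ L.gen (k + n) := by rw [L.covers]; trivial
    obtain ⟨K, hK, hpK⟩ := hc
    have hIK : I ⊆ K := by
      rcases L.subdiv _ I hI K hK with h | h
      · exact h
      · exact absurd hpK (Set.disjoint_left.mp h hx)
    rcases ih K hK with h | h
    · left; exact hIK.trans h
    · right; exact h.mono_left hIK

theorem RLattice.nested (L : RLattice) {I J : Set ℝ} (hI : I ∈ L.lat) (hJ : J ∈ L.lat) :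
    I ⊆ J ∨ J ⊆ I ∨ Disjoint I J := by
  obtain ⟨i, hi⟩ := hI
  obtain ⟨j, hj⟩ := hJ
  rcases le_total i j with h | h
  · obtain ⟨n, rfl⟩ := Int.le.dest h
    rcases L.nested_aux i I hi n J hj with h | h
    · exact Or.inr (Or.inl h)
    · exact Or.inr (Or.inr h.symm)
  · obtain ⟨n, rfl⟩ := Int.le.dest h
    rcases L.nested_aux j J hj n I hi with h | h
    · exact Or.inl h
    · exact Or.inr (Or.inr h)

theorem RLattice.carleson_finset (L : RLattice) (b : Set ℝ → ℝ) (C : ℝ)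
    (hCar : L.IsCarleson b C) (E : Set ℝ) (F : Finset (Set ℝ))
    (hF : ∀ I ∈ F, I ∈ L.lat ∧ I ⊆ E) :
    ∑ I ∈ F, ENNReal.ofReal (b I) ≤ ENNReal.ofReal C * volume E := by
  set G : Finset (Set ℝ) := F.filter (fun I => Maximal (· ∈ F) I) with hG
  have hex : ∀ I : Set ℝ, ∃ M, I ∈ F → (M ∈ G ∧ I ⊆ M) := by
    intro I
    by_cases hI : I ∈ F
    · obtain ⟨M, hM, hmax⟩ := F.exists_le_maximal hI
      exact ⟨M, fun _ => ⟨Finset.mem_filter.mpr ⟨hmax.prop, hmax⟩, hM⟩⟩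
    · exact ⟨∅, fun h => absurd h hI⟩
  choose g hg using hex
  have hmaps : ∀ I ∈ F, g I ∈ G := fun I hI => (hg I hI).1
  have hGF : ∀ M ∈ G, M ∈ F := fun M hM => (Finset.mem_filter.mp hM).1
  rw [← Finset.sum_fiberwise_of_maps_to hmaps]
  have h1 : ∀ M ∈ G, ∑ I ∈ F.filter (fun I => g I = M), ENNReal.ofReal (b I)
      ≤ ENNReal.ofReal C * volume M := by
    intro M hM
    refine le_trans ?_ (hCar M (Or.inl (hF M (hGF M hM)).1))
    refine le_trans ?_ (le_of_eq
      (tsum_subtype {J : Set ℝ | J ∈ L.lat ∧ J ⊆ M} (fun J => ENNReal.ofReal (b J))).symm)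
    refine le_trans (le_of_eq ?_) (ENNReal.sum_le_tsum (F.filter (fun I => g I = M)))
    refine Finset.sum_congr rfl fun I hI => ?_
    obtain ⟨hIF, hIM⟩ := Finset.mem_filter.mp hI
    rw [Set.indicator_of_mem]
    exact ⟨(hF I hIF).1, hIM ▸ (hg I hIF).2⟩
  refine (Finset.sum_le_sum h1).trans ?_
  rw [← Finset.mul_sum]
  gcongr
  have hdisj : (G : Set (Set ℝ)).PairwiseDisjoint id := by
    intro M hM N hN hne
    have hM' := Finset.mem_filter.mp hM
    have hN' := Finset.mem_filter.mp hN
    rcases L.nested (hF M hM'.1).1 (hF N hN'.1).1 with h | h | h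
    · exact absurd (hM'.2.eq_of_le hN'.1 h) hne
    · exact absurd (hN'.2.eq_of_le hM'.1 h).symm hne
    · exact h
  have hmeas : ∀ M ∈ G, MeasurableSet (id M) := by
    intro M hM
    obtain ⟨k, hk⟩ := (hF M (hGF M hM)).1
    obtain ⟨p, q, -, hE⟩ := L.isInterval k M hk
    simp only [id, hE]
    exact measurableSet_Ico
  have := measure_biUnion_finset (μ := volume) hdisj hmeas
  simp only [id] at this
  rw [← this]
  refine measure_mono ?_
  exact Set.iUnion₂_subset fun M hM => (hF M (hGF M hM)).2

theorem layer_bound (ε : ℝ) (hε : 0 < ε) (v : ℝ) :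
    ENNReal.ofReal v ≤ ENNReal.ofReal ε *
      ∑' k : ℤ, (if (1 + ε) ^ k < v then ENNReal.ofReal ((1 + ε) ^ k) else 0) := by
  rcases le_or_gt v 0 with hv | hv
  · rw [ENNReal.ofReal_of_nonpos hv]; exact zero_le
  obtain ⟨m, hm1, hm2⟩ := exists_mem_Ioc_zpow hv (show (1 : ℝ) < 1 + ε by linarith)
  have hl : (0 : ℝ) < 1 + ε := by linarith
  have hinj : Function.Injective (fun n : ℕ => m - (n : ℤ)) := by
    intro x y h; simp only at h; omega
  have hs : HasSum (fun n : ℕ => (1 + ε) ^ (m - (n : ℤ))) ((1 + ε) ^ (m + 1) / ε) := by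
    have h := (hasSum_geometric_of_lt_one (r := (1 + ε)⁻¹) (by positivity)
      (inv_lt_one_of_one_lt₀ (by linarith))).mul_left ((1 + ε) ^ m)
    have e1 : (fun n : ℕ => (1 + ε) ^ (m - (n : ℤ))) =
        fun n : ℕ => (1 + ε) ^ m * (1 + ε)⁻¹ ^ n := by
      funext n
      rw [zpow_sub₀ hl.ne', zpow_natCast, inv_pow, div_eq_mul_inv]
    have e2 : (1 + ε) ^ (m + 1) / ε = (1 + ε) ^ m * (1 - (1 + ε)⁻¹)⁻¹ := by
      rw [zpow_add_one₀ hl.ne']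
      have : 1 - (1 + ε)⁻¹ = ε / (1 + ε) := by field_simp; ring
      rw [this]; field_simp
    rw [e1, e2]
    exact h
  have h2 : ENNReal.ofReal ((1 + ε) ^ (m + 1) / ε) ≤
      ∑' k : ℤ, (if (1 + ε) ^ k < v then ENNReal.ofReal ((1 + ε) ^ k) else 0) := by
    rw [← hs.tsum_eq, ENNReal.ofReal_tsum_of_nonneg (fun n => by positivity) hs.summable]
    refine le_trans (le_of_eq ?_) (ENNReal.tsum_comp_le_tsum_of_injective hinj _)
    refine tsum_congr fun n => ?_
    rw [if_pos]
    refine lt_of_le_of_lt ?_ hm1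
    exact zpow_le_zpow_right₀ (by linarith) (by omega)
  refine le_trans ?_ (mul_le_mul_right h2 _)
  rw [← ENNReal.ofReal_mul hε.le]
  apply ENNReal.ofReal_le_ofReal
  rwa [mul_div_cancel₀ _ hε.ne']

/-- with `E_k = {Mf > (1+ε)^k}` and `(|a_I|)` Carleson with constant `C`,
`Σ_I |⟨f⟩_I||a_I| ≤ ε Σ_k (1+ε)^k |E_k| · C`. -/
theorem stmt15 (L : RLattice) (f : ℝ → ℝ)
    (hf : MeasureTheory.LocallyIntegrable f MeasureTheory.volume)
    (a : Set ℝ → ℝ) (C : ℝ) (hC : 0 < C) (hCar : L.IsCarleson (fun I => |a I|) C)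
    (ε : ℝ) (hε : 0 < ε) :
    ∑' I : L.lat, ENNReal.ofReal (|avgOn f I.1| * |a I.1|)
      ≤ ENNReal.ofReal ε *
          (∑' k : ℤ, ENNReal.ofReal ((1 + ε) ^ k) *
            MeasureTheory.volume {x | ENNReal.ofReal ((1 + ε) ^ k) < L.maxFn f x}) *
          ENNReal.ofReal C := by
  have hlev : ∀ k : ℤ, ∑' I : L.lat,
      (if (1 + ε) ^ k < |avgOn f I.1| then ENNReal.ofReal |a I.1| else 0) ≤
      ENNReal.ofReal C * volume {x | ENNReal.ofReal ((1 + ε) ^ k) < L.maxFn f x} := by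
    intro k
    rw [ENNReal.tsum_eq_iSup_sum]
    refine iSup_le fun s => ?_
    rw [← Finset.sum_filter]
    have := L.carleson_finset (fun I => |a I|) C hCar
      {x | ENNReal.ofReal ((1 + ε) ^ k) < L.maxFn f x}
      ((s.filter (fun I => (1 + ε) ^ k < |avgOn f I.1|)).map (Function.Embedding.subtype _)) ?_
    · rw [Finset.sum_map] at this
      exact this
    · intro I hI
      obtain ⟨⟨J, hJ⟩, hJs, rfl⟩ := Finset.mem_map.mp hI
      have hlt := (Finset.mem_filter.mp hJs).2
      refine ⟨hJ, fun x hx => ?_⟩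
      have h1 : ENNReal.ofReal |avgOn f J| ≤ L.maxFn f x :=
        le_iSup₂ (f := fun (I : Set ℝ) (_ : I ∈ L.lat ∧ x ∈ I) => ENNReal.ofReal |avgOn f I|)
          J ⟨hJ, hx⟩
      refine lt_of_lt_of_le ?_ h1
      exact (ENNReal.ofReal_lt_ofReal_iff_of_nonneg (by positivity)).mpr hlt
  calc ∑' I : L.lat, ENNReal.ofReal (|avgOn f I.1| * |a I.1|)
      ≤ ∑' I : L.lat, ENNReal.ofReal ε * ∑' k : ℤ, ENNReal.ofReal ((1 + ε) ^ k) *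
          (if (1 + ε) ^ k < |avgOn f I.1| then ENNReal.ofReal |a I.1| else 0) := by
        refine ENNReal.tsum_le_tsum fun I => ?_
        rw [ENNReal.ofReal_mul (abs_nonneg _)]
        refine (mul_le_mul_left (layer_bound ε hε _) _).trans (le_of_eq ?_)
        rw [mul_assoc, ← ENNReal.tsum_mul_right]
        congr 1
        refine tsum_congr fun k => ?_
        split_ifs <;> simp
    _ = ENNReal.ofReal ε * ∑' k : ℤ, ENNReal.ofReal ((1 + ε) ^ k) * ∑' I : L.lat,
          (if (1 + ε) ^ k < |avgOn f I.1| then ENNReal.ofReal |a I.1| else 0) := by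
        rw [ENNReal.tsum_mul_left, ENNReal.tsum_comm]
        simp_rw [ENNReal.tsum_mul_left]
    _ ≤ ENNReal.ofReal ε * ∑' k : ℤ, ENNReal.ofReal ((1 + ε) ^ k) * (ENNReal.ofReal C *
          volume {x | ENNReal.ofReal ((1 + ε) ^ k) < L.maxFn f x}) := by
        gcongr with k
        exact hlev k
    _ = _ := by
        rw [mul_assoc, ← ENNReal.tsum_mul_right]
        congr 1
        refine tsum_congr fun k => ?_
        ring

end
end

section
/- Let ℒ be a lattice on ℝ and let (a_I)_{I∈ℒ} be real numbers such that (|a_I|)_{I∈ℒ} is a Carleson sequence, with balayage g = Σ_{I∈ℒ} (1/|I|) a_I 1_I. Then for every I ∈ ℒ one has the variance bound ⟨g²⟩_I − (⟨g⟩_I)² ≤ 2 Carl(|a_I|)², and the pointwise bound |Δ_I g| ≤ 2 Carl(|a_I|) everywhere. -/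
open MeasureTheory Set Filter
open scoped ENNReal Topology Classical

noncomputable section

namespace RLattice

variable (L : RLattice)

lemma gen_nested {m : ℤ} {I : Set ℝ} (hI : I ∈ L.gen m) (n : ℕ) :
    ∀ J ∈ L.gen (m + n), J ⊆ I ∨ Disjoint J I := by
  induction n with
  | zero =>
    intro J hJ
    simp only [Nat.cast_zero, add_zero] at hJ
    by_cases h : J = I
    · left; rw [h]
    · right; exact L.pairwise_disjoint m hJ hI h
  | succ n ih =>
    intro J hJ
    have hJ' : J ∈ L.gen ((m + n) + 1) := by
      have : m + ((n + 1 : ℕ) : ℤ) = (m + n) + 1 := by push_cast; ring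
      rwa [this] at hJ
    obtain ⟨p, q, hpq, hJe⟩ := L.isInterval _ J hJ'
    have hp : p ∈ J := by rw [hJe]; exact ⟨le_rfl, hpq⟩
    have hpu : p ∈ ⋃₀ L.gen (m + n) := by rw [L.covers]; trivial
    obtain ⟨M, hM, hpM⟩ := hpu
    have hJM : J ⊆ M := by
      rcases L.subdiv _ J hJ' M hM with h | h
      · exact h
      · exact absurd hpM (Set.disjoint_left.1 h hp)
    rcases ih M hM with h | h
    · left; exact hJM.trans h
    · right; exact h.mono_left hJM

lemma gen_nested' {m n : ℤ} (hmn : m ≤ n) {I J : Set ℝ} (hI : I ∈ L.gen m) (hJ : J ∈ L.gen n) :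
    J ⊆ I ∨ Disjoint J I := by
  obtain ⟨k, hk⟩ := Int.le.dest hmn
  rw [← hk] at hJ
  exact L.gen_nested hI k J hJ

lemma lat_nested {I J : Set ℝ} (hI : I ∈ L.lat) (hJ : J ∈ L.lat) :
    J ⊆ I ∨ I ⊆ J ∨ Disjoint J I := by
  obtain ⟨m, hm⟩ := hI
  obtain ⟨n, hn⟩ := hJ
  rcases le_total m n with h | h
  · rcases L.gen_nested' h hm hn with h | h
    · exact Or.inl h
    · exact Or.inr (Or.inr h)
  · rcases L.gen_nested' h hn hm with h | h
    · exact Or.inr (Or.inl h)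
    · exact Or.inr (Or.inr h.symm)

lemma lat_countable_s18 : L.lat.Countable := by
  have : L.lat = ⋃ k, L.gen k := by ext I; simp [lat]
  rw [this]
  refine Set.countable_iUnion fun k => ?_
  refine (L.pairwise_disjoint k).countable_of_nonempty_interior ?_
  intro I hI
  obtain ⟨p, q, hpq, rfl⟩ := L.isInterval k I hI
  simpa using hpq

instance : Countable L.lat := L.lat_countable_s18.to_subtype

lemma lat_meas_s18 {I : Set ℝ} (hI : I ∈ L.lat) : MeasurableSet I := by
  obtain ⟨k, hk⟩ := hI
  obtain ⟨p, q, hpq, rfl⟩ := L.isInterval k I hk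
  exact measurableSet_Ico

lemma lat_vol {I : Set ℝ} (hI : I ∈ L.lat) : volume I ≠ 0 ∧ volume I ≠ ⊤ := by
  obtain ⟨k, hk⟩ := hI
  obtain ⟨p, q, hpq, rfl⟩ := L.isInterval k I hk
  simp [hpq]

/-- The ENNReal coefficient restricted to subintervals of `I`. -/
def ee (a : Set ℝ → ℝ) (I : Set ℝ) (K : L.lat) : ℝ≥0∞ :=
  if K.1 ⊆ I then ENNReal.ofReal |a K.1| else 0

/-- One term of the absolute local balayage. -/
def hh (a : Set ℝ → ℝ) (I : Set ℝ) (K : L.lat) (x : ℝ) : ℝ≥0∞ :=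
  K.1.indicator (fun _ => (volume K.1)⁻¹ * L.ee a I K) x

/-- The absolute local balayage. -/
def HH (a : Set ℝ → ℝ) (I : Set ℝ) (x : ℝ) : ℝ≥0∞ := ∑' K, L.hh a I K x

/-- One term of the balayage. -/
def ff (a : Set ℝ → ℝ) (x : ℝ) (K : L.lat) : ℝ :=
  (K.1).indicator (fun _ => (MeasureTheory.volume K.1).toReal⁻¹ * a K.1) x

lemma hh_meas (a : Set ℝ → ℝ) (I : Set ℝ) (K : L.lat) : Measurable (L.hh a I K) :=
  measurable_const.indicator (L.lat_meas_s18 K.2)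

lemma HH_meas (a : Set ℝ → ℝ) (I : Set ℝ) : Measurable (L.HH a I) :=
  Measurable.tsum fun K => L.hh_meas a I K

lemma ff_meas (a : Set ℝ → ℝ) (K : L.lat) : Measurable (fun x => L.ff a x K) :=
  measurable_const.indicator (L.lat_meas_s18 K.2)

variable {L}

lemma sum_ee {a : Set ℝ → ℝ} {C : ℝ} (hCar : L.IsCarleson (fun I => |a I|) C) {I : Set ℝ}
    (hI : I ∈ L.lat) : ∑' K, L.ee a I K ≤ ENNReal.ofReal C * volume I := by
  refine le_trans (le_of_eq ?_) (hCar I (Or.inl hI))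
  have h1 := tsum_subtype (L.lat) (fun K : Set ℝ => if K ⊆ I then ENNReal.ofReal |a K| else 0)
  have h2 := tsum_subtype {J : Set ℝ | J ∈ L.lat ∧ J ⊆ I} (fun K : Set ℝ => ENNReal.ofReal |a K|)
  refine h1.trans (Eq.trans ?_ h2.symm)
  congr 1
  ext K
  by_cases h : K ∈ L.lat <;> by_cases h' : K ⊆ I <;> simp [Set.indicator, h, h']

lemma lint_HH {a : Set ℝ → ℝ} {C : ℝ} (hCar : L.IsCarleson (fun I => |a I|) C) {I : Set ℝ}
    (hI : I ∈ L.lat) : ∫⁻ x, L.HH a I x ≤ ENNReal.ofReal C * volume I := by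
  refine le_trans (le_of_eq ?_) (sum_ee hCar hI)
  unfold HH
  rw [lintegral_tsum fun K => (L.hh_meas a I K).aemeasurable]
  congr 1
  ext K
  unfold hh
  rw [lintegral_indicator_const (L.lat_meas_s18 K.2)]
  rw [mul_right_comm, ENNReal.inv_mul_cancel (L.lat_vol K.2).1 (L.lat_vol K.2).2, one_mul]

lemma lint_hh_mul (a : Set ℝ → ℝ) (I : Set ℝ) (K M : L.lat) :
    ∫⁻ x, L.hh a I K x * L.hh a I M x ≤
      (if K.1 ⊆ M.1 then (L.ee a I M * (volume M.1)⁻¹) * L.ee a I K else 0) +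
      (if M.1 ⊆ K.1 then (L.ee a I K * (volume K.1)⁻¹) * L.ee a I M else 0) := by
  have key : ∀ K M : L.lat, K.1 ⊆ M.1 → ∫⁻ x, L.hh a I K x * L.hh a I M x =
      (L.ee a I M * (volume M.1)⁻¹) * L.ee a I K := by
    intro K M h
    have : ∀ x, L.hh a I K x * L.hh a I M x = K.1.indicator (fun _ =>
        ((volume K.1)⁻¹ * L.ee a I K) * ((volume M.1)⁻¹ * L.ee a I M)) x := by
      intro x
      unfold hh
      by_cases hx : x ∈ K.1
      · simp [hx, h hx]
      · simp [hx]
    simp_rw [this]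
    rw [lintegral_indicator_const (L.lat_meas_s18 K.2)]
    calc _ = ((volume K.1)⁻¹ * volume K.1) * ((L.ee a I M * (volume M.1)⁻¹) * L.ee a I K) := by
          ring
      _ = _ := by
        rw [ENNReal.inv_mul_cancel (L.lat_vol K.2).1 (L.lat_vol K.2).2, one_mul]
  rcases L.lat_nested M.2 K.2 with h | h | h
  · rw [key K M h, if_pos h]
    exact le_self_add
  · simp_rw [mul_comm (L.hh a I K _)]
    rw [key M K h, if_pos h]
    exact le_add_self
  · have : ∀ x, L.hh a I K x * L.hh a I M x = 0 := by
      intro x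
      unfold hh
      by_cases hx : x ∈ K.1
      · simp [Set.disjoint_left.1 h hx]
      · simp [hx]
    simp [this]

lemma half_sum {a : Set ℝ → ℝ} {C : ℝ} (hCar : L.IsCarleson (fun I => |a I|) C) {I : Set ℝ}
    (hI : I ∈ L.lat) :
    ∑' M : L.lat, ∑' K : L.lat,
      (if K.1 ⊆ M.1 then (L.ee a I M * (volume M.1)⁻¹) * L.ee a I K else 0) ≤
    ENNReal.ofReal C * (ENNReal.ofReal C * volume I) := by
  calc _ ≤ ∑' M : L.lat, ENNReal.ofReal C * L.ee a I M := by
        refine ENNReal.tsum_le_tsum fun M => ?_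
        calc _ ≤ ∑' K : L.lat, (L.ee a I M * (volume M.1)⁻¹) * L.ee a M.1 K := by
              refine ENNReal.tsum_le_tsum fun K => ?_
              split_ifs with h
              · gcongr
                unfold ee
                rw [if_pos h]
                split_ifs <;> simp
              · simp
          _ = (L.ee a I M * (volume M.1)⁻¹) * ∑' K : L.lat, L.ee a M.1 K := by
              rw [ENNReal.tsum_mul_left]
          _ ≤ (L.ee a I M * (volume M.1)⁻¹) * (ENNReal.ofReal C * volume M.1) := by
              gcongr
              exact sum_ee hCar M.2
          _ = ((volume M.1)⁻¹ * volume M.1) * (ENNReal.ofReal C * L.ee a I M) := by ring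
          _ = _ := by
              rw [ENNReal.inv_mul_cancel (L.lat_vol M.2).1 (L.lat_vol M.2).2, one_mul]
    _ = ENNReal.ofReal C * ∑' M : L.lat, L.ee a I M := by rw [ENNReal.tsum_mul_left]
    _ ≤ _ := by
      gcongr
      exact sum_ee hCar hI

lemma lint_HH_sq {a : Set ℝ → ℝ} {C : ℝ} (hCar : L.IsCarleson (fun I => |a I|) C) {I : Set ℝ}
    (hI : I ∈ L.lat) :
    ∫⁻ x, (L.HH a I x) ^ 2 ≤ 2 * (ENNReal.ofReal C * (ENNReal.ofReal C * volume I)) := by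
  have h1 : ∀ x, (L.HH a I x) ^ 2 = ∑' M, ∑' K, L.hh a I K x * L.hh a I M x := by
    intro x
    rw [sq]
    unfold HH
    simp_rw [ENNReal.tsum_mul_right, ENNReal.tsum_mul_left]
  simp_rw [h1]
  have h0 : ∀ M, Measurable fun x => ∑' K, L.hh a I K x * L.hh a I M x := fun M =>
    Measurable.tsum fun K => (L.hh_meas a I K).mul (L.hh_meas a I M)
  rw [lintegral_tsum fun M => (h0 M).aemeasurable]
  have h2 : ∀ M, ∫⁻ x, ∑' K, L.hh a I K x * L.hh a I M x =
      ∑' K, ∫⁻ x, L.hh a I K x * L.hh a I M x := fun M =>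
    lintegral_tsum fun K => ((L.hh_meas a I K).mul (L.hh_meas a I M)).aemeasurable
  simp_rw [h2]
  calc _ ≤ ∑' M : L.lat, ∑' K : L.lat,
      ((if K.1 ⊆ M.1 then (L.ee a I M * (volume M.1)⁻¹) * L.ee a I K else 0) +
      (if M.1 ⊆ K.1 then (L.ee a I K * (volume K.1)⁻¹) * L.ee a I M else 0)) :=
        ENNReal.tsum_le_tsum fun M => ENNReal.tsum_le_tsum fun K => lint_hh_mul a I K M
    _ ≤ _ := by
      simp_rw [ENNReal.tsum_add]
      rw [two_mul]
      gcongr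
      · exact half_sum hCar hI
      · rw [ENNReal.tsum_comm]
        exact half_sum hCar hI

lemma hh_eq (a : Set ℝ → ℝ) {I : Set ℝ} {K : L.lat} (h : K.1 ⊆ I) (x : ℝ) :
    L.hh a I K x = ENNReal.ofReal |L.ff a x K| := by
  unfold hh ff ee
  by_cases hx : x ∈ K.1
  · simp only [hx, Set.indicator_of_mem, h, if_true, abs_mul]
    rw [ENNReal.ofReal_mul (abs_nonneg _), abs_of_nonneg (inv_nonneg.2 ENNReal.toReal_nonneg : 0 ≤ (volume K.1).toReal⁻¹),
      ENNReal.ofReal_inv_of_pos (ENNReal.toReal_pos (L.lat_vol K.2).1 (L.lat_vol K.2).2),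
      ENNReal.ofReal_toReal (L.lat_vol K.2).2]
  · simp [hx]

lemma core_pt (a : Set ℝ → ℝ) {I : Set ℝ} (u : L.lat → ℝ) (hu : Summable u) (x : ℝ)
    (hr : ∀ K : L.lat, L.ff a x K ≠ u K → K.1 ⊆ I ∧ |L.ff a x K - u K| ≤ |L.ff a x K|)
    (hfin : L.HH a I x ≠ ⊤) :
    Summable (L.ff a x) ∧ |L.balayage a x - ∑' K, u K| ≤ (L.HH a I x).toReal := by
  have hs : Summable fun K => (L.hh a I K x).toReal := ENNReal.summable_toReal hfin
  have hb : ∀ K, ‖L.ff a x K - u K‖ ≤ (L.hh a I K x).toReal := by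
    intro K
    by_cases h : L.ff a x K = u K
    · simp [h]
    · obtain ⟨h1, h2⟩ := hr K h
      rw [hh_eq a h1, ENNReal.toReal_ofReal (abs_nonneg _)]
      exact h2
  have hd : Summable fun K => L.ff a x K - u K := Summable.of_norm_bounded hs hb
  have hf : Summable (L.ff a x) := by simpa using hd.add hu
  refine ⟨hf, ?_⟩
  have : L.balayage a x = ∑' K, L.ff a x K := rfl
  rw [this, ← hf.tsum_sub hu]
  have h3 := tsum_of_norm_bounded hs.hasSum hb
  rw [← ENNReal.tsum_toReal_eq (fun K => ENNReal.ne_top_of_tsum_ne_top hfin K)] at h3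
  exact h3

/-- main analytic estimate -/
lemma core {a : Set ℝ → ℝ} {C : ℝ} (hC : 0 < C) (hCar : L.IsCarleson (fun I => |a I|) C)
    {I : Set ℝ} (hI : I ∈ L.lat) (u : L.lat → ℝ) (hu : Summable u)
    (hr : ∀ x ∈ I, ∀ K : L.lat, L.ff a x K ≠ u K →
      K.1 ⊆ I ∧ |L.ff a x K - u K| ≤ |L.ff a x K|) :
    |avgOn (L.balayage a) I - ∑' K, u K| ≤ C ∧
    avgOn (fun x => (L.balayage a x) ^ 2) I - (avgOn (L.balayage a) I) ^ 2 ≤ 2 * C ^ 2 := by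
  set c := ∑' K, u K with hc
  set μ := volume.restrict I with hμ
  obtain ⟨hv0, hvt⟩ := L.lat_vol hI
  haveI : IsFiniteMeasure μ := ⟨by simpa [hμ] using hvt.lt_top⟩
  have hvpos : 0 < (volume I).toReal := ENNReal.toReal_pos hv0 hvt
  set V := (volume I).toReal with hV
  have hμV : μ.real univ = V := by simp [hμ, hV, Measure.real]
  have hH1 : ∫⁻ x, L.HH a I x ∂μ ≤ ENNReal.ofReal (C * V) := by
    refine (lintegral_mono' Measure.restrict_le_self le_rfl).trans ((lint_HH hCar hI).trans ?_)
    rw [ENNReal.ofReal_mul hC.le, hV, ENNReal.ofReal_toReal hvt]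
  have hH2 : ∫⁻ x, (L.HH a I x) ^ 2 ∂μ ≤ ENNReal.ofReal (2 * C ^ 2 * V) := by
    refine (lintegral_mono' Measure.restrict_le_self le_rfl).trans ((lint_HH_sq hCar hI).trans ?_)
    rw [ENNReal.ofReal_mul (by positivity), ENNReal.ofReal_mul (by positivity), hV,
      ENNReal.ofReal_toReal hvt, ENNReal.ofReal_pow hC.le]
    simp only [ENNReal.ofReal_ofNat]
    apply le_of_eq; ring
  have hfin : ∀ᵐ x ∂μ, L.HH a I x < ⊤ :=
    ae_lt_top (L.HH_meas a I) (hH1.trans_lt ENNReal.ofReal_lt_top).ne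
  have hpt : ∀ᵐ x ∂μ, Summable (L.ff a x) ∧ |L.balayage a x - c| ≤ (L.HH a I x).toReal := by
    filter_upwards [hfin, ae_restrict_mem (L.lat_meas_s18 hI)] with x hx hxI
    exact core_pt a u hu x (hr x hxI) hx.ne
  have hgm : AEMeasurable (L.balayage a) μ := by
    refine aemeasurable_of_tendsto_metrizable_ae (u := (atTop : Filter (Finset L.lat)))
      (f := fun s x => ∑ K ∈ s, L.ff a x K) ?_ ?_
    · intro s
      exact (Finset.measurable_fun_sum s fun K _ => L.ff_meas a K).aemeasurable
    · filter_upwards [hpt] with x hx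
      exact hx.1.hasSum
  have hgc : AEStronglyMeasurable (fun x => L.balayage a x - c) μ :=
    (hgm.sub_const c).aestronglyMeasurable
  have hle : ∀ᵐ x ∂μ, ENNReal.ofReal |L.balayage a x - c| ≤ L.HH a I x := by
    filter_upwards [hpt, hfin] with x hx hx'
    exact ENNReal.ofReal_le_of_le_toReal hx.2
  have hl1 : ∫⁻ x, ENNReal.ofReal |L.balayage a x - c| ∂μ ≤ ENNReal.ofReal (C * V) :=
    (lintegral_mono_ae hle).trans hH1
  have hl2 : ∫⁻ x, ENNReal.ofReal ((L.balayage a x - c) ^ 2) ∂μ ≤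
      ENNReal.ofReal (2 * C ^ 2 * V) := by
    refine le_trans (lintegral_mono_ae ?_) hH2
    filter_upwards [hle] with x hx
    rw [← sq_abs, ENNReal.ofReal_pow (abs_nonneg _)]
    gcongr
  have hi1 : Integrable (fun x => L.balayage a x - c) μ := by
    refine ⟨hgc, ?_⟩
    rw [hasFiniteIntegral_iff_norm]
    exact hl1.trans_lt ENNReal.ofReal_lt_top
  have hi2 : Integrable (fun x => (L.balayage a x - c) ^ 2) μ := by
    refine ⟨hgc.pow 2, ?_⟩
    rw [hasFiniteIntegral_iff_ofReal (ae_of_all _ fun x => sq_nonneg _)]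
    exact hl2.trans_lt ENNReal.ofReal_lt_top
  have hb1 : |∫ x, (L.balayage a x - c) ∂μ| ≤ C * V := by
    refine (abs_integral_le_integral_abs).trans ?_
    rw [integral_eq_lintegral_of_nonneg_ae (ae_of_all _ fun x => abs_nonneg _) hgc.norm]
    exact ENNReal.toReal_le_of_le_ofReal (by positivity) hl1
  have hb2 : ∫ x, (L.balayage a x - c) ^ 2 ∂μ ≤ 2 * C ^ 2 * V := by
    rw [integral_eq_lintegral_of_nonneg_ae (ae_of_all _ fun x => sq_nonneg _) (hgc.pow 2)]
    exact ENNReal.toReal_le_of_le_ofReal (by positivity) hl2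
  set A := ∫ x, (L.balayage a x - c) ∂μ with hA
  set B := ∫ x, (L.balayage a x - c) ^ 2 ∂μ with hB
  have e1 : ∫ x, L.balayage a x ∂μ = A + c * V := by
    have : ∀ x, L.balayage a x = (L.balayage a x - c) + c := fun x => by ring
    rw [integral_congr_ae (ae_of_all _ this), integral_add hi1 (integrable_const c),
      integral_const, hμV, smul_eq_mul]
    ring
  have e2 : ∫ x, (L.balayage a x) ^ 2 ∂μ = B + 2 * c * A + c ^ 2 * V := by
    have : ∀ x, (L.balayage a x) ^ 2 =
      ((L.balayage a x - c) ^ 2 + 2 * c * (L.balayage a x - c)) + c ^ 2 := fun x => by ring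
    have hi3 : Integrable (fun x => (L.balayage a x - c) ^ 2 + 2 * c * (L.balayage a x - c)) μ :=
      hi2.add (hi1.const_mul (2 * c))
    rw [integral_congr_ae (ae_of_all _ this), integral_add hi3 (integrable_const _),
      integral_add hi2 (hi1.const_mul (2 * c)), integral_const_mul,
      integral_const, hμV, smul_eq_mul]
    ring
  unfold avgOn
  rw [← hμ, ← hV, e1, e2]
  constructor
  · have : V⁻¹ * (A + c * V) - c = V⁻¹ * A := by field_simp; ring
    rw [this, abs_mul, abs_of_pos (inv_pos.2 hvpos), inv_mul_le_iff₀ hvpos]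
    linarith
  · have : V⁻¹ * (B + 2 * c * A + c ^ 2 * V) - (V⁻¹ * (A + c * V)) ^ 2 =
      V⁻¹ * B - (V⁻¹ * A) ^ 2 := by field_simp; ring
    rw [this]
    have h3 : V⁻¹ * B ≤ 2 * C ^ 2 := by
      rw [inv_mul_le_iff₀ hvpos]; linarith
    nlinarith [sq_nonneg (V⁻¹ * A)]

/-- The weights of the intervals containing `I`. -/
def uu (L : RLattice) (a : Set ℝ → ℝ) (I : Set ℝ) (K : L.lat) : ℝ :=
  if I ⊆ K.1 then (volume K.1).toReal⁻¹ * a K.1 else 0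

lemma hr_of (a : Set ℝ → ℝ) {I J : Set ℝ} (hJI : J ⊆ I)
    (h : ∀ K ∈ L.lat, I ⊆ K ∨ K ⊆ J ∨ Disjoint K J) :
    ∀ x ∈ J, ∀ K : L.lat, L.ff a x K ≠ L.uu a I K →
      K.1 ⊆ J ∧ |L.ff a x K - L.uu a I K| ≤ |L.ff a x K| := by
  intro x hx K hne
  by_cases hIK : I ⊆ K.1
  · exact absurd (by simp [ff, uu, hIK, hIK (hJI hx)]) hne
  · rcases h K.1 K.2 with h | h | h
    · exact absurd h hIK
    · exact ⟨h, by simp [uu, hIK]⟩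
    · exact absurd (by simp [ff, uu, hIK, Set.disjoint_right.1 h hx]) hne

lemma bal_zero (a : Set ℝ → ℝ) {I : Set ℝ} (hu : ¬ Summable (L.uu a I)) :
    ∀ x ∈ I, L.balayage a x = 0 := by
  intro x hx
  refine tsum_eq_zero_of_not_summable fun hs => hu ?_
  have := Summable.indicator hs {K : L.lat | I ⊆ K.1}
  refine this.congr fun K => ?_
  by_cases h : I ⊆ K.1
  · simp [uu, h, h hx]
  · simp [uu, h]

lemma avg_zero {f : ℝ → ℝ} {J : Set ℝ} (hJ : MeasurableSet J) (h : ∀ x ∈ J, f x = 0) :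
    avgOn f J = 0 := by
  unfold avgOn
  rw [setIntegral_eq_zero_of_forall_eq_zero h, mul_zero]

lemma delta_bound {f : ℝ → ℝ} {I : Set ℝ} {D : ℝ} (hD : 0 ≤ D)
    (h : ∀ J ∈ L.children I, |avgOn f J - avgOn f I| ≤ D) (x : ℝ) : |L.deltaI f I x| ≤ D := by
  unfold deltaI
  split_ifs with hne
  swap
  · simpa using hD
  obtain ⟨J0, k, hIk, hIk', hJ0, hJ0I⟩ := hne
  have huniq : ∀ J ∈ L.children I, J ∈ L.gen (k + 1) ∧ J ⊆ I := by
    rintro J ⟨m, hm, hm', hJ, hJI⟩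
    have hmem : ∀ p q : ℤ, I ∈ L.gen p → I ∈ L.gen q → p < q → I ∈ L.gen (p + 1) := by
      intro p q hp hq hpq
      obtain ⟨y, z, hyz, hIe⟩ := L.isInterval _ I hp
      have hy : y ∈ I := by rw [hIe]; exact ⟨le_rfl, hyz⟩
      have hyu : y ∈ ⋃₀ L.gen (p + 1) := by rw [L.covers]; trivial
      obtain ⟨M, hM, hyM⟩ := hyu
      have h1 : M ⊆ I := (L.subdiv p M hM I hp).resolve_right
        fun hd => Set.disjoint_left.1 hd hyM hy
      have h2 : I ⊆ M := (L.gen_nested' (by omega) hM hq).resolve_right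
        fun hd => Set.disjoint_left.1 hd hy hyM
      rwa [Set.Subset.antisymm h2 h1]
    have : m = k := by
      rcases lt_trichotomy m k with hlt | he | hlt
      · exact absurd (hmem m k hm hIk hlt) hm'
      · exact he
      · exact absurd (hmem k m hIk hm hlt) hIk'
    subst this
    exact ⟨hJ, hJI⟩
  by_cases hx : x ∈ I
  · have hxu : x ∈ ⋃₀ L.gen (k + 1) := by rw [L.covers]; trivial
    obtain ⟨M, hM, hxM⟩ := hxu
    have hMI : M ⊆ I := (L.subdiv k M hM I hIk).resolve_right
        fun hd => Set.disjoint_left.1 hd hxM hx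
    have hMc : M ∈ L.children I := ⟨k, hIk, hIk', hM, hMI⟩
    rw [tsum_eq_single (⟨M, hMc⟩ : L.children I)]
    · simpa [avgInd, hx, hxM] using h M hMc
    · rintro ⟨J, hJ⟩ hJM
      have hJM' : J ≠ M := fun e => hJM (Subtype.ext e)
      have := L.pairwise_disjoint (k + 1) (huniq J hJ).1 hM hJM'
      have hxJ : x ∉ J := Set.disjoint_right.1 this hxM
      simp [avgInd, hxJ]
  · have : ∀ J : L.children I, avgInd f J.1 x = 0 := by
      intro J
      have : x ∉ J.1 := fun hxJ => hx ((huniq J.1 J.2).2 hxJ)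
      simp [avgInd, this]
    simp only [this, tsum_zero]
    simpa [avgInd, hx] using hD

end RLattice

/-- if `(|a_I|)` is Carleson with constant `C` and `g` is the balayage of
`(a_I)`, then for every `I ∈ ℒ`, `⟨g²⟩_I - (⟨g⟩_I)² ≤ 2C²` and `|Δ_I g| ≤ 2C` everywhere. -/
theorem stmt18 (L : RLattice) (a : Set ℝ → ℝ) (C : ℝ) (hC : 0 < C)
    (hCar : L.IsCarleson (fun I => |a I|) C) :
    ∀ I ∈ L.lat,
      (avgOn (fun x => (L.balayage a x) ^ 2) I - (avgOn (L.balayage a) I) ^ 2 ≤ 2 * C ^ 2) ∧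
      ∀ x, |L.deltaI (L.balayage a) I x| ≤ 2 * C := by
  intro I hI
  by_cases hu : Summable (L.uu a I)
  · have hcI := RLattice.core hC hCar hI _ hu (RLattice.hr_of a (Set.Subset.refl I)
      fun K hK => by
        rcases L.lat_nested hI hK with h | h | h
        · exact Or.inr (Or.inl h)
        · exact Or.inl h
        · exact Or.inr (Or.inr h))
    refine ⟨hcI.2, RLattice.delta_bound (by positivity) ?_⟩
    rintro J ⟨k, hIk, hIk', hJ, hJI⟩
    have hcJ := RLattice.core hC hCar (I := J) ⟨_, hJ⟩ _ hu (RLattice.hr_of a hJI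
      fun K hK => by
        obtain ⟨m, hm⟩ := hK
        rcases lt_or_ge k m with hkm | hkm
        · exact Or.inr (L.gen_nested' (by omega) hJ hm)
        · rcases L.gen_nested' hkm hm hIk with h | h
          · exact Or.inl h
          · exact Or.inr (Or.inr (h.mono_left hJI).symm))
    have h1 := abs_le.1 hcI.1
    have h2 := abs_le.1 hcJ.1
    exact abs_le.2 ⟨by linarith [h1.2, h2.1], by linarith [h1.1, h2.2]⟩
  · have hz := RLattice.bal_zero a hu
    have hm := L.lat_meas_s18 hI
    refine ⟨?_, RLattice.delta_bound (by positivity) ?_⟩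
    · rw [RLattice.avg_zero hm hz, RLattice.avg_zero hm (fun x hx => by simp [hz x hx])]
      have := sq_nonneg C
      linarith
    · rintro J ⟨k, hIk, hIk', hJ, hJI⟩
      rw [RLattice.avg_zero hm hz, RLattice.avg_zero (L.lat_meas_s18 ⟨_, hJ⟩)
        (fun x hx => hz x (hJI hx))]
      simpa using hC.le

end
end
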